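/- Let 0 < ν < 1 and σ > 0, and set f₀(s) = e^{−s²/(2σ²)} + i (2/√π) F(s/(√2 σ)). Then for every real t, the function t ↦ (1/Γ(1−ν)) ∫_{−∞}^{t} (t − s)^{−ν} f₀(s) ds is differentiable and its derivative satisfies d/dt [(1/Γ(1−ν)) ∫_{−∞}^{t} (t − s)^{−ν} f₀(s) ds] = √(2/π) ∫_0^∞ e^{−ω²/2} (ω/σ)^{ν} e^{i(ω t/σ + νπ/2)} dω; i.e. the ν-th Riemann–Liouville fractional derivative of f₀ based at −∞ has the stated one-sided Fourier representation. -/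

import Mathlib

open MeasureTheory Real

/-- Dawson's integral `F(x) = (1/2) ∫_0^∞ e^{-t²/4} sin(xt) dt`. -/
noncomputable def dawson (x : ℝ) : ℝ :=
  (1 / 2) * ∫ t in Set.Ioi (0:ℝ), Real.exp (-t ^ 2 / 4) * Real.sin (x * t)

/-- `f₀(s) = e^{-s²/(2σ²)} + i (2/√π) F(s/(√2 σ))`. -/
noncomputable def f0 (σ : ℝ) (s : ℝ) : ℂ :=
  ((Real.exp (-s ^ 2 / (2 * σ ^ 2)) : ℝ) : ℂ) +
    Complex.I * (((2 / Real.sqrt Real.pi) * dawson (s / (Real.sqrt 2 * σ)) : ℝ) : ℂ)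

open Set Filter Topology

lemma integrableOn_rpow_mul_exp_neg_mul_Ioi {a b : ℝ} (ha : -1 < a) (hb : 0 < b) :
    IntegrableOn (fun x : ℝ => x ^ a * Real.exp (-(b * x))) (Ioi 0) := by
  simpa using integrableOn_rpow_mul_exp_neg_mul_rpow ha (p := 1) one_pos hb

lemma norm_ofReal_mul_cexp_neg_mul {c t : ℝ} (hc : 0 ≤ c) (z : ℂ) :
    ‖(c : ℂ) * Complex.exp (-(z * t))‖ = c * Real.exp (-(z.re * t)) := by
  simp [Complex.norm_exp, abs_of_nonneg hc]

/-- The Laplace transform of a real power at a complex argument of positive real part. -/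
lemma integral_rpow_mul_cexp_neg_mul_Ioi {a : ℝ} (ha : 0 < a) {z : ℂ} (hz : 0 < z.re) :
    ∫ t in Ioi (0 : ℝ), ((t ^ (a - 1) : ℝ) : ℂ) * Complex.exp (-(z * t)) =
      z ^ (-a : ℂ) * Real.Gamma a := by
  set U : Set ℂ := {z : ℂ | 0 < z.re} with hU
  have hUo : IsOpen U := Complex.continuous_re.isOpen_preimage _ isOpen_Ioi
  have hUc : IsPreconnected U := (convex_halfSpace_re_gt 0).isPreconnected
  have hmeas : ∀ w : ℂ, AEStronglyMeasurable
      (fun t : ℝ => ((t ^ (a - 1) : ℝ) : ℂ) * Complex.exp (-(w * t)))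
      (volume.restrict (Ioi 0)) := fun w => by
    apply Measurable.aestronglyMeasurable
    fun_prop
  have h1 : DifferentiableOn ℂ
      (fun w : ℂ => ∫ t in Ioi (0 : ℝ), ((t ^ (a - 1) : ℝ) : ℂ) * Complex.exp (-(w * t))) U := by
    intro w hw
    have hw : 0 < w.re := hw
    refine (hasDerivAt_integral_of_dominated_loc_of_deriv_le
      (s := {v : ℂ | w.re / 2 < v.re})
      (F' := fun v t => ((t ^ (a - 1) : ℝ) : ℂ) * (Complex.exp (-(v * t)) * (-t)))
      (bound := fun t => t ^ a * Real.exp (-(w.re / 2 * t))) ?_ (Eventually.of_forall hmeas)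
      ?_ ?_ ?_ ?_ ?_).2.differentiableAt.differentiableWithinAt
    · exact (Complex.continuous_re.isOpen_preimage _ isOpen_Ioi).mem_nhds
        (show w.re / 2 < w.re by linarith)
    · refine (integrableOn_rpow_mul_exp_neg_mul_Ioi (a := a - 1) (by linarith) hw).mono'
        (hmeas w) ?_
      filter_upwards [ae_restrict_mem measurableSet_Ioi] with t ht
      exact (norm_ofReal_mul_cexp_neg_mul (rpow_nonneg (le_of_lt ht) _) w).le
    · apply Measurable.aestronglyMeasurable
      fun_prop
    · filter_upwards [ae_restrict_mem measurableSet_Ioi] with t ht v hv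
      have ht : 0 < t := ht
      have hv : w.re / 2 < v.re := hv
      rw [← mul_assoc, norm_mul, norm_ofReal_mul_cexp_neg_mul (rpow_nonneg ht.le _) v, norm_neg,
        Complex.norm_real, Real.norm_of_nonneg ht.le, mul_right_comm, ← rpow_add_one ht.ne',
        sub_add_cancel]
      gcongr
    · exact integrableOn_rpow_mul_exp_neg_mul_Ioi (by linarith) (by linarith)
    · refine Eventually.of_forall fun t v _ => ?_
      have : HasDerivAt (fun v : ℂ => -(v * t)) (-(t : ℂ)) v := by
        convert! ((hasDerivAt_id v).mul_const (t : ℂ)).neg using 1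
        simp
      exact this.cexp.const_mul _
  have h2 : DifferentiableOn ℂ (fun w : ℂ => w ^ (-a : ℂ) * (Real.Gamma a : ℂ)) U := by
    intro w hw
    exact ((differentiableAt_id.cpow_const (Or.inl hw)).mul_const _).differentiableWithinAt
  refine AnalyticOnNhd.eqOn_of_preconnected_of_frequently_eq (h1.analyticOnNhd hUo)
    (h2.analyticOnNhd hUo) hUc (z₀ := 1) (by simp [hU]) ?_ hz
  have hreal : ∀ r : ℝ, 0 < r →
      ∫ t in Ioi (0 : ℝ), ((t ^ (a - 1) : ℝ) : ℂ) * Complex.exp (-((r : ℂ) * t)) =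
        (r : ℂ) ^ (-a : ℂ) * (Real.Gamma a : ℂ) := by
    intro r hr
    have := Real.integral_rpow_mul_exp_neg_mul_Ioi ha hr
    rw [← Complex.ofReal_neg, ← Complex.ofReal_cpow hr.le, rpow_neg hr.le, ← inv_rpow hr.le,
      ← one_div, ← Complex.ofReal_mul, ← this, ← integral_complex_ofReal]
    simp
  have htend : Tendsto (fun n : ℕ => ((1 + 1 / ((n : ℝ) + 1) : ℝ) : ℂ)) atTop (𝓝[≠] 1) := by
    refine tendsto_nhdsWithin_iff.2 ⟨?_, Eventually.of_forall fun n => ?_⟩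
    · have := (tendsto_one_div_add_atTop_nhds_zero_nat (𝕜 := ℝ)).const_add 1
      simpa [Function.comp_def] using (Complex.continuous_ofReal.tendsto _).comp this
    · have : (1 + 1 / ((n : ℝ) + 1) : ℝ) ≠ 1 := by
        have : 0 < 1 / ((n : ℝ) + 1) := by positivity
        linarith
      exact fun h => this (Complex.ofReal_eq_one.1 h)
  exact htend.frequently (Frequently.of_forall fun n => hreal _ (by positivity))

/-- The one-sided Fourier transform of the Gaussian. -/
noncomputable def halfGaussianFourier (x : ℝ) : ℂ :=
  ∫ ω in Ioi (0 : ℝ), ((Real.exp (-ω ^ 2 / 2) : ℝ) : ℂ) * Complex.exp (Complex.I * (ω * x : ℝ))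

lemma norm_ofReal_mul_cexp_I_mul {c : ℝ} (hc : 0 ≤ c) (y : ℝ) :
    ‖(c : ℂ) * Complex.exp (Complex.I * (y : ℝ))‖ = c := by
  rw [mul_comm Complex.I, norm_mul, Complex.norm_exp_ofReal_mul_I, mul_one, Complex.norm_real,
    Real.norm_of_nonneg hc]

lemma integrableOn_rpow_mul_exp_neg_sq_div_two {a : ℝ} (ha : -1 < a) :
    IntegrableOn (fun ω : ℝ => ω ^ a * Real.exp (-ω ^ 2 / 2)) (Ioi 0) := by
  refine (integrableOn_rpow_mul_exp_neg_mul_sq (b := 1 / 2) (by norm_num) ha).congr_fun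
    (fun ω _ => ?_) measurableSet_Ioi
  dsimp only
  congr 2
  ring

lemma integrable_exp_neg_sq_div_two : Integrable (fun ω : ℝ => Real.exp (-ω ^ 2 / 2)) := by
  convert! integrable_exp_neg_mul_sq (b := 1 / 2) (by norm_num) using 3
  ring

lemma integrable_exp_neg_sq_div_two_mul_cexp (x : ℝ) :
    Integrable (fun ω : ℝ => ((Real.exp (-ω ^ 2 / 2) : ℝ) : ℂ) *
      Complex.exp (Complex.I * (ω * x : ℝ))) := by
  refine integrable_exp_neg_sq_div_two.mono' (by fun_prop) (Eventually.of_forall fun ω => ?_)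
  exact (norm_ofReal_mul_cexp_I_mul (Real.exp_pos _).le _).le

lemma continuous_halfGaussianFourier : Continuous halfGaussianFourier := by
  refine continuous_of_dominated (bound := fun ω => Real.exp (-ω ^ 2 / 2))
    (fun x => (integrable_exp_neg_sq_div_two_mul_cexp x).integrableOn.1)
    (fun x => Eventually.of_forall fun ω =>
      (norm_ofReal_mul_cexp_I_mul (Real.exp_pos _).le _).le)
    integrable_exp_neg_sq_div_two.integrableOn (Eventually.of_forall fun ω => by fun_prop)

lemma integral_cos_mul_exp_neg_sq_div_two (x : ℝ) :
    ∫ ω in Ioi (0 : ℝ), Real.exp (-ω ^ 2 / 2) * Real.cos (ω * x) =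
      √(π / 2) * Real.exp (-x ^ 2 / 2) := by
  have h1 := fourierIntegral_gaussian (b := 1 / 2) (by norm_num) (x : ℂ)
  have h2 : ∫ ω : ℝ, Real.exp (-ω ^ 2 / 2) * Real.cos (ω * x) =
      √(2 * π) * Real.exp (-x ^ 2 / 2) := by
    have h3 := integral_re (integrable_exp_neg_sq_div_two_mul_cexp x)
    have h4 : ∀ ω : ℝ, RCLike.re (((Real.exp (-ω ^ 2 / 2) : ℝ) : ℂ) *
        Complex.exp (Complex.I * (ω * x : ℝ))) = Real.exp (-ω ^ 2 / 2) * Real.cos (ω * x) := by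
      intro ω
      rw [RCLike.re_eq_complex_re, Complex.re_ofReal_mul, mul_comm Complex.I,
        Complex.exp_ofReal_mul_I_re]
    simp_rw [h4] at h3
    rw [h3]
    have h5 : ∫ ω : ℝ, ((Real.exp (-ω ^ 2 / 2) : ℝ) : ℂ) *
        Complex.exp (Complex.I * (ω * x : ℝ)) = ((√(2 * π) * Real.exp (-x ^ 2 / 2) : ℝ) : ℂ) := by
      convert h1 using 1
      · congr 1 with ω
        push_cast
        rw [mul_comm]
        congr 2 <;> ring
      · push_cast
        rw [Real.sqrt_eq_rpow, Complex.ofReal_cpow (by positivity)]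
        push_cast
        congr 2 <;> ring
    rw [h5, RCLike.re_eq_complex_re, Complex.ofReal_re]
  have h6 := integral_comp_abs (f := fun ω : ℝ => Real.exp (-ω ^ 2 / 2) * Real.cos (ω * x))
  have h7 : ∀ ω : ℝ, Real.cos (|ω| * x) = Real.cos (ω * x) := fun ω => by
    rcases abs_choice ω with h | h <;> simp [h]
  simp only [sq_abs, h7] at h6
  have h8 : √(2 * π) = 2 * √(π / 2) := by
    rw [show 2 * π = 2 ^ 2 * (π / 2) by ring, Real.sqrt_mul (by norm_num),
      Real.sqrt_sq (by norm_num)]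
  rw [h2, h8] at h6
  linarith

lemma dawson_div_sqrt_two (x : ℝ) :
    dawson (x / √2) = √2 / 2 * ∫ ω in Ioi (0 : ℝ), Real.exp (-ω ^ 2 / 2) * Real.sin (ω * x) := by
  have h2 : (0 : ℝ) < √2 := by positivity
  have h := integral_comp_mul_left_Ioi
    (fun t : ℝ => Real.exp (-t ^ 2 / 4) * Real.sin (x / √2 * t)) 0 h2
  rw [mul_zero, smul_eq_mul] at h
  have h3 : ∀ ω : ℝ, Real.exp (-(√2 * ω) ^ 2 / 4) * Real.sin (x / √2 * (√2 * ω)) =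
      Real.exp (-ω ^ 2 / 2) * Real.sin (ω * x) := fun ω => by
    rw [mul_pow, Real.sq_sqrt (by norm_num)]
    congr 2
    · ring
    · field_simp
  simp_rw [h3] at h
  rw [h, dawson, ← mul_assoc]
  congr 1
  field_simp

lemma f0_eq {σ : ℝ} (hσ : 0 < σ) (s : ℝ) :
    f0 σ s = (√(2 / π) : ℝ) * halfGaussianFourier (s / σ) := by
  have hi := (integrable_exp_neg_sq_div_two_mul_cexp (s / σ)).integrableOn (s := Ioi 0)
  have hre : (halfGaussianFourier (s / σ)).re =
      ∫ ω in Ioi (0 : ℝ), Real.exp (-ω ^ 2 / 2) * Real.cos (ω * (s / σ)) := by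
    rw [halfGaussianFourier, ← RCLike.re_eq_complex_re, ← integral_re hi]
    congr 1 with ω
    rw [RCLike.re_eq_complex_re, Complex.re_ofReal_mul, mul_comm Complex.I,
      Complex.exp_ofReal_mul_I_re]
  have him : (halfGaussianFourier (s / σ)).im =
      ∫ ω in Ioi (0 : ℝ), Real.exp (-ω ^ 2 / 2) * Real.sin (ω * (s / σ)) := by
    rw [halfGaussianFourier, ← RCLike.im_eq_complex_im, ← integral_im hi]
    congr 1 with ω
    rw [RCLike.im_eq_complex_im, Complex.im_ofReal_mul, mul_comm Complex.I,
      Complex.exp_ofReal_mul_I_im]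
  rw [integral_cos_mul_exp_neg_sq_div_two] at hre
  have hd : s / (√2 * σ) = s / σ / √2 := by rw [div_div, mul_comm]
  rw [f0, hd, dawson_div_sqrt_two, ← him]
  have hc : √(2 / π) * √(π / 2) = 1 := by
    rw [← Real.sqrt_mul (by positivity), div_mul_div_cancel₀ (by positivity)]
    simp
  apply Complex.ext
  · rw [Complex.re_ofReal_mul, hre, ← mul_assoc √(2 / π), hc, one_mul]
    rw [Complex.add_re, Complex.ofReal_re, Complex.I_mul_re, Complex.ofReal_im, neg_zero, add_zero]
    congr 1
    field_simp
  · rw [Complex.im_ofReal_mul, Real.sqrt_div (by norm_num), Complex.add_im, Complex.ofReal_im,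
      Complex.I_mul_im, Complex.ofReal_re]
    ring

lemma norm_halfGaussianFourier_le (x : ℝ) : |x| * ‖halfGaussianFourier x‖ ≤ 2 := by
  set e : ℝ → ℂ := fun ω => ((Real.exp (-ω ^ 2 / 2) : ℝ) : ℂ) *
      Complex.exp (Complex.I * (ω * x : ℝ)) with he
  have hnorm : ∀ ω, ‖e ω‖ = Real.exp (-ω ^ 2 / 2) := fun ω =>
    norm_ofReal_mul_cexp_I_mul (Real.exp_pos _).le _
  have hei : IntegrableOn e (Ioi 0) := (integrable_exp_neg_sq_div_two_mul_cexp x).integrableOn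
  have hb : IntegrableOn (fun ω : ℝ => ω * Real.exp (-ω ^ 2 / 2)) (Ioi 0) := by
    simpa using integrableOn_rpow_mul_exp_neg_sq_div_two (a := 1) (by norm_num)
  have hωe : IntegrableOn (fun ω : ℝ => (ω : ℂ) * e ω) (Ioi 0) := by
    refine hb.mono' (by fun_prop) ?_
    filter_upwards [ae_restrict_mem measurableSet_Ioi] with ω hω
    rw [norm_mul, hnorm, Complex.norm_real, Real.norm_of_nonneg (le_of_lt hω)]
  have hderiv : ∀ ω : ℝ, HasDerivAt e (Complex.I * x * e ω - ω * e ω) ω := fun ω => by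
    have h1 : HasDerivAt (fun ω : ℝ => -ω ^ 2 / 2) (-ω) ω := by
      convert! ((hasDerivAt_pow 2 ω).neg.div_const 2) using 1
      simp
      ring
    have h2 : HasDerivAt (fun ω : ℝ => Complex.I * ((ω * x : ℝ) : ℂ)) (Complex.I * x) ω := by
      simpa using ((hasDerivAt_id ω).mul_const x).ofReal_comp.const_mul Complex.I
    convert! h1.exp.ofReal_comp.mul h2.cexp using 1
    simp only [he]
    push_cast
    ring
  have hlim : Tendsto (fun ω : ℝ => Real.exp (-ω ^ 2 / 2)) atTop (𝓝 0) := by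
    refine Real.tendsto_exp_atBot.comp ?_
    have : Tendsto (fun ω : ℝ => ω ^ 2) atTop atTop := tendsto_pow_atTop (by norm_num)
    exact (tendsto_neg_atTop_atBot.comp this).atBot_div_const (by norm_num)
  have hI := integral_Ioi_of_hasDerivAt_of_tendsto (a := 0)
    (hderiv 0).continuousAt.continuousWithinAt (fun ω _ => hderiv ω)
    ((hei.const_mul (Complex.I * x)).sub hωe)
    (tendsto_zero_iff_norm_tendsto_zero.2 (by simpa only [hnorm] using hlim))
  rw [integral_sub (hei.const_mul (Complex.I * x)) hωe, integral_const_mul] at hI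
  have he0 : e 0 = 1 := by simp [he]
  have hhalf : ∫ ω in Ioi (0 : ℝ), e ω = halfGaussianFourier x := rfl
  rw [he0, hhalf, sub_eq_iff_eq_add] at hI
  have hle : ‖∫ ω in Ioi (0 : ℝ), (ω : ℂ) * e ω‖ ≤ 1 := by
    have h1 : ∫ ω in Ioi (0 : ℝ), ω * Real.exp (-ω ^ 2 / 2) = 1 := by
      have := integral_mul_cexp_neg_mul_sq (b := 1 / 2) (by norm_num)
      norm_num at this
      rw [← Complex.ofReal_inj, ← integral_complex_ofReal, Complex.ofReal_one, ← this]
      congr 1 with ω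
      push_cast
      congr 2
      ring
    rw [← h1]
    refine norm_integral_le_of_norm_le hb ?_
    filter_upwards [ae_restrict_mem measurableSet_Ioi] with ω hω
    rw [norm_mul, hnorm, Complex.norm_real, Real.norm_of_nonneg (le_of_lt hω)]
  calc |x| * ‖halfGaussianFourier x‖ = ‖Complex.I * x * halfGaussianFourier x‖ := by simp
    _ = ‖0 - 1 + ∫ ω in Ioi (0 : ℝ), (ω : ℂ) * e ω‖ := by rw [hI]
    _ ≤ ‖(0 - 1 : ℂ)‖ + ‖∫ ω in Ioi (0 : ℝ), (ω : ℂ) * e ω‖ := norm_add_le _ _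
    _ ≤ 1 + 1 := add_le_add (by simp) hle
    _ = 2 := by norm_num

lemma exists_norm_halfGaussianFourier_le : ∃ C, ∀ x, ‖halfGaussianFourier x‖ ≤ C :=
  ⟨_, fun _ => norm_integral_le_of_norm_le integrable_exp_neg_sq_div_two.integrableOn
    (Eventually.of_forall fun _ => (norm_ofReal_mul_cexp_I_mul (Real.exp_pos _).le _).le)⟩

lemma integrableOn_rpow_mul_halfGaussianFourier {ν σ : ℝ} (hν0 : 0 < ν) (hν1 : ν < 1)
    (hσ : 0 < σ) (u : ℝ) :
    IntegrableOn (fun r : ℝ => ((r ^ (-ν) : ℝ) : ℂ) * halfGaussianFourier ((u - r) / σ))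
      (Ioi 0) := by
  have hH : Continuous fun r : ℝ => halfGaussianFourier ((u - r) / σ) :=
    continuous_halfGaussianFourier.comp (by fun_prop)
  have hmeas : Measurable
      fun r : ℝ => ((r ^ (-ν) : ℝ) : ℂ) * halfGaussianFourier ((u - r) / σ) :=
    Measurable.mul (by fun_prop) hH.measurable
  obtain ⟨C, hC⟩ := exists_norm_halfGaussianFourier_le
  set R := 2 * |u| + 1 with hR
  have hR0 : 0 < R := by positivity
  rw [← Ioc_union_Ioi_eq_Ioi hR0.le]
  refine IntegrableOn.union ?_ ?_
  · have h := (intervalIntegral.intervalIntegrable_rpow' (a := 0) (b := R) (r := -ν)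
      (by linarith)).1.mul_const C
    refine h.mono' hmeas.aestronglyMeasurable ?_
    filter_upwards [ae_restrict_mem measurableSet_Ioc] with r hr
    rw [norm_mul, Complex.norm_real, Real.norm_of_nonneg (rpow_nonneg hr.1.le _)]
    exact mul_le_mul_of_nonneg_left (hC _) (rpow_nonneg hr.1.le _)
  · have h := (integrableOn_Ioi_rpow_of_lt (a := -ν - 1) (by linarith) hR0).mul_const (4 * σ)
    refine h.mono' hmeas.aestronglyMeasurable ?_
    filter_upwards [ae_restrict_mem measurableSet_Ioi] with r hr
    have hr : R < r := hr
    have hr0 : 0 < r := hR0.trans hr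
    rw [norm_mul, Complex.norm_real, Real.norm_of_nonneg (rpow_nonneg hr0.le _),
      rpow_sub_one hr0.ne', div_mul_eq_mul_div, mul_div_assoc]
    refine mul_le_mul_of_nonneg_left ?_ (rpow_nonneg hr0.le _)
    have h1 := norm_halfGaussianFourier_le ((u - r) / σ)
    have h2 : r / 2 ≤ |u - r| := by
      rw [abs_sub_comm]
      have := le_abs_self (r - u)
      have := le_abs_self u
      have := abs_nonneg u
      linarith
    rw [abs_div, abs_of_pos hσ, div_mul_eq_mul_div, div_le_iff₀ hσ] at h1
    have h3 := mul_le_mul_of_nonneg_right h2 (norm_nonneg (halfGaussianFourier ((u - r) / σ)))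
    rw [le_div_iff₀ hr0]
    linarith

lemma integral_rpow_mul_exp_mul_halfGaussianFourier {ν σ ε : ℝ} (hν1 : ν < 1)
    (hε : 0 < ε) (u : ℝ) :
    ∫ r in Ioi (0 : ℝ), ((r ^ (-ν) * Real.exp (-(ε * r)) : ℝ) : ℂ) *
        halfGaussianFourier ((u - r) / σ) =
      Real.Gamma (1 - ν) * ∫ ω in Ioi (0 : ℝ), ((Real.exp (-ω ^ 2 / 2) : ℝ) : ℂ) *
        Complex.exp (Complex.I * (ω * (u / σ) : ℝ)) *
        (ε + (ω / σ : ℝ) * Complex.I) ^ (ν - 1 : ℂ) := by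
  have hI : Integrable (Function.uncurry fun r ω : ℝ =>
      ((r ^ (-ν) * Real.exp (-(ε * r)) : ℝ) : ℂ) * (((Real.exp (-ω ^ 2 / 2) : ℝ) : ℂ) *
        Complex.exp (Complex.I * (ω * ((u - r) / σ) : ℝ))))
      ((volume.restrict (Ioi 0)).prod (volume.restrict (Ioi 0))) := by
    have h := (integrableOn_rpow_mul_exp_neg_mul_Ioi (a := -ν) (by linarith) hε).norm.mul_prod
      (integrable_exp_neg_sq_div_two.integrableOn (s := Ioi 0))
    refine h.mono' ?_ (Eventually.of_forall fun p => ?_)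
    · apply Measurable.aestronglyMeasurable
      unfold Function.uncurry
      fun_prop
    · simp only [Function.uncurry]
      rw [norm_mul, norm_ofReal_mul_cexp_I_mul (Real.exp_pos _).le, Complex.norm_real]
  simp_rw [halfGaussianFourier, ← integral_const_mul]
  rw [integral_integral_swap hI]
  refine setIntegral_congr_fun measurableSet_Ioi fun ω _ => ?_
  have hre : 0 < ((ε : ℂ) + (ω / σ : ℝ) * Complex.I).re := by simpa using hε
  have h := integral_rpow_mul_cexp_neg_mul_Ioi (a := 1 - ν) (by linarith) hre
  rw [show (-((1 - ν : ℝ) : ℂ)) = ν - 1 by push_cast; ring, show 1 - ν - 1 = -ν by ring] at h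
  rw [mul_left_comm, mul_comm (Real.Gamma (1 - ν) : ℂ), ← h, ← integral_const_mul]
  congr 1 with r
  have hexp : Complex.exp (Complex.I * (ω * ((u - r) / σ) : ℝ)) * Complex.exp (-(ε * r : ℝ)) =
      Complex.exp (Complex.I * (ω * (u / σ) : ℝ)) *
        Complex.exp (-((ε + (ω / σ : ℝ) * Complex.I) * r)) := by
    rw [← Complex.exp_add, ← Complex.exp_add]
    congr 1
    push_cast
    ring
  rw [Complex.ofReal_mul, Complex.ofReal_exp (-(ε * r)), Complex.ofReal_neg]
  linear_combination (((r ^ (-ν) : ℝ) : ℂ) * ((Real.exp (-ω ^ 2 / 2) : ℝ) : ℂ)) * hexp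

lemma norm_ofReal_mul_I_cpow {y : ℝ} (hy : 0 < y) (a : ℝ) :
    ‖((y : ℂ) * Complex.I) ^ (a : ℂ)‖ = y ^ a := by
  rw [Complex.norm_cpow_real]
  simp [abs_of_pos hy]

lemma integral_rpow_mul_halfGaussianFourier {ν σ : ℝ} (hν0 : 0 < ν) (hν1 : ν < 1)
    (hσ : 0 < σ) (u : ℝ) :
    ∫ r in Ioi (0 : ℝ), ((r ^ (-ν) : ℝ) : ℂ) * halfGaussianFourier ((u - r) / σ) =
      Real.Gamma (1 - ν) * ∫ ω in Ioi (0 : ℝ), ((Real.exp (-ω ^ 2 / 2) : ℝ) : ℂ) *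
        Complex.exp (Complex.I * (ω * (u / σ) : ℝ)) *
        ((ω / σ : ℝ) * Complex.I) ^ (ν - 1 : ℂ) := by
  have hH : Continuous fun r : ℝ => halfGaussianFourier ((u - r) / σ) :=
    continuous_halfGaussianFourier.comp (by fun_prop)
  have hl : Tendsto (fun ε : ℝ => ∫ r in Ioi (0 : ℝ),
      ((r ^ (-ν) * Real.exp (-(ε * r)) : ℝ) : ℂ) * halfGaussianFourier ((u - r) / σ))
      (𝓝[>] 0)
      (𝓝 (∫ r in Ioi (0 : ℝ), ((r ^ (-ν) : ℝ) : ℂ) * halfGaussianFourier ((u - r) / σ))) := by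
    refine tendsto_integral_filter_of_dominated_convergence _ (Eventually.of_forall fun ε => ?_)
      ?_ (integrableOn_rpow_mul_halfGaussianFourier hν0 hν1 hσ u).norm ?_
    · exact (Measurable.mul (by fun_prop) hH.measurable).aestronglyMeasurable
    · filter_upwards [self_mem_nhdsWithin] with ε hε
      filter_upwards [ae_restrict_mem measurableSet_Ioi] with r hr
      have : Real.exp (-(ε * r)) ≤ 1 := by
        rw [Real.exp_le_one_iff, neg_nonpos]
        exact mul_nonneg (le_of_lt hε) (le_of_lt hr)
      rw [norm_mul, norm_mul, Complex.norm_real, Complex.norm_real, norm_mul,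
        Real.norm_of_nonneg (Real.exp_pos _).le]
      gcongr
      exact mul_le_of_le_one_right (norm_nonneg _) this
    · refine Eventually.of_forall fun r => tendsto_nhdsWithin_of_tendsto_nhds ?_
      have : Continuous fun ε : ℝ =>
        ((r ^ (-ν) * Real.exp (-(ε * r)) : ℝ) : ℂ) * halfGaussianFourier ((u - r) / σ) := by
        fun_prop
      simpa using this.tendsto 0
  have hcast : (ν - 1 : ℂ) = ((ν - 1 : ℝ) : ℂ) := by push_cast; rfl
  have hr : Tendsto (fun ε : ℝ => Real.Gamma (1 - ν) * ∫ ω in Ioi (0 : ℝ),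
      ((Real.exp (-ω ^ 2 / 2) : ℝ) : ℂ) * Complex.exp (Complex.I * (ω * (u / σ) : ℝ)) *
        (ε + (ω / σ : ℝ) * Complex.I) ^ (ν - 1 : ℂ)) (𝓝[>] 0)
      (𝓝 (Real.Gamma (1 - ν) * ∫ ω in Ioi (0 : ℝ), ((Real.exp (-ω ^ 2 / 2) : ℝ) : ℂ) *
        Complex.exp (Complex.I * (ω * (u / σ) : ℝ)) *
        ((ω / σ : ℝ) * Complex.I) ^ (ν - 1 : ℂ))) := by
    refine Tendsto.const_mul _ (tendsto_integral_filter_of_dominated_convergence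
      (fun ω => ω ^ (ν - 1) * Real.exp (-ω ^ 2 / 2) * (σ ^ (ν - 1))⁻¹)
      (Eventually.of_forall fun ε => ?_) ?_
      ((integrableOn_rpow_mul_exp_neg_sq_div_two (by linarith)).mul_const _) ?_)
    · apply Measurable.aestronglyMeasurable
      fun_prop
    · filter_upwards [self_mem_nhdsWithin] with ε hε
      filter_upwards [ae_restrict_mem measurableSet_Ioi] with ω hω
      have hω : 0 < ω := hω
      have hpos : 0 < ω / σ := div_pos hω hσ
      rw [norm_mul, norm_ofReal_mul_cexp_I_mul (Real.exp_pos _).le, hcast,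
        Complex.norm_cpow_real, mul_comm (ω ^ (ν - 1)), mul_assoc, ← div_eq_mul_inv,
        ← Real.div_rpow hω.le hσ.le]
      refine mul_le_mul_of_nonneg_left ?_ (Real.exp_pos _).le
      refine Real.rpow_le_rpow_of_nonpos hpos ?_ (by linarith)
      refine le_trans (le_abs_self _) (le_trans (le_of_eq ?_) (Complex.abs_im_le_norm _))
      simp
    · filter_upwards [ae_restrict_mem measurableSet_Ioi] with ω hω
      have hω : 0 < ω := hω
      have hpos : 0 < ω / σ := div_pos hω hσ
      refine (tendsto_nhdsWithin_of_tendsto_nhds ?_).const_mul _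
      have hc : ContinuousAt
          (fun ε : ℝ => ((ε : ℂ) + (ω / σ : ℝ) * Complex.I) ^ (ν - 1 : ℂ)) 0 := by
        refine ContinuousAt.cpow (by fun_prop) continuousAt_const ?_
        exact Or.inr (by simpa using ⟨hω.ne', hσ.ne'⟩)
      simpa [ContinuousAt] using hc
  refine tendsto_nhds_unique hl (hr.congr' ?_)
  filter_upwards [self_mem_nhdsWithin] with ε hε
  exact (integral_rpow_mul_exp_mul_halfGaussianFourier hν1 hε u).symm

lemma ofReal_mul_I_cpow {y : ℝ} (hy : 0 < y) (ν : ℝ) :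
    ((y : ℂ) * Complex.I) ^ (ν : ℂ) =
      ((y ^ ν : ℝ) : ℂ) * Complex.exp (Complex.I * (ν * π / 2)) := by
  have hy' : (y : ℂ) ≠ 0 := Complex.ofReal_ne_zero.2 hy.ne'
  rw [Complex.cpow_def_of_ne_zero (mul_ne_zero hy' Complex.I_ne_zero),
    Complex.log_ofReal_mul hy Complex.I_ne_zero, Complex.log_I, add_mul, Complex.exp_add,
    Complex.ofReal_cpow hy.le, Complex.cpow_def_of_ne_zero hy', Complex.ofReal_log hy.le]
  congr 2
  ring

lemma setIntegral_Iio_eq_setIntegral_Ioi_sub (g : ℝ → ℂ) (u : ℝ) :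
    ∫ s in Iio u, g s = ∫ r in Ioi (0 : ℝ), g (u - r) := by
  rw [← integral_indicator measurableSet_Iio, ← integral_indicator measurableSet_Ioi,
    ← integral_sub_left_eq_self _ volume u]
  congr 1 with r
  simp [indicator]

lemma hasDerivAt_integral_exp_mul_cexp_mul_cpow {ν σ : ℝ} (hν0 : 0 < ν) (hσ : 0 < σ) (t : ℝ) :
    HasDerivAt (fun u : ℝ => ∫ ω in Ioi (0 : ℝ), ((Real.exp (-ω ^ 2 / 2) : ℝ) : ℂ) *
        Complex.exp (Complex.I * (ω * (u / σ) : ℝ)) * ((ω / σ : ℝ) * Complex.I) ^ (ν - 1 : ℂ))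
      (∫ ω in Ioi (0 : ℝ), ((Real.exp (-ω ^ 2 / 2) : ℝ) : ℂ) *
        Complex.exp (Complex.I * (ω * (t / σ) : ℝ)) * ((ω / σ : ℝ) * Complex.I) ^ (ν : ℂ)) t := by
  have hcast : (ν - 1 : ℂ) = ((ν - 1 : ℝ) : ℂ) := by push_cast; rfl
  have hbound : ∀ a u ω : ℝ, 0 < ω → ‖((Real.exp (-ω ^ 2 / 2) : ℝ) : ℂ) *
      Complex.exp (Complex.I * (ω * (u / σ) : ℝ)) * ((ω / σ : ℝ) * Complex.I) ^ (a : ℂ)‖ =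
      ω ^ a * Real.exp (-ω ^ 2 / 2) * (σ ^ a)⁻¹ := fun a u ω hω => by
    rw [norm_mul, norm_ofReal_mul_cexp_I_mul (Real.exp_pos _).le,
      norm_ofReal_mul_I_cpow (div_pos hω hσ), Real.div_rpow hω.le hσ.le]
    ring
  have hmeas : ∀ a : ℂ, ∀ u : ℝ, AEStronglyMeasurable
      (fun ω : ℝ => ((Real.exp (-ω ^ 2 / 2) : ℝ) : ℂ) *
        Complex.exp (Complex.I * (ω * (u / σ) : ℝ)) * ((ω / σ : ℝ) * Complex.I) ^ a)
      (volume.restrict (Ioi 0)) := fun a u => by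
    apply Measurable.aestronglyMeasurable
    fun_prop
  refine (hasDerivAt_integral_of_dominated_loc_of_deriv_le (s := univ)
    (F' := fun (u : ℝ) (ω : ℝ) => ((Real.exp (-ω ^ 2 / 2) : ℝ) : ℂ) *
      Complex.exp (Complex.I * (ω * (u / σ) : ℝ)) * ((ω / σ : ℝ) * Complex.I) ^ (ν : ℂ))
    (bound := fun ω => ω ^ ν * Real.exp (-ω ^ 2 / 2) * (σ ^ ν)⁻¹) univ_mem
    (Eventually.of_forall (hmeas _)) ?_ (hmeas _ t) ?_
    ((integrableOn_rpow_mul_exp_neg_sq_div_two (by linarith)).mul_const _) ?_).2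
  · refine ((integrableOn_rpow_mul_exp_neg_sq_div_two (a := ν - 1)
      (by linarith)).mul_const (σ ^ (ν - 1))⁻¹).mono' (hmeas _ t) ?_
    filter_upwards [ae_restrict_mem measurableSet_Ioi] with ω hω
    rw [hcast]
    exact (hbound _ _ _ hω).le
  · filter_upwards [ae_restrict_mem measurableSet_Ioi] with ω hω u _
    exact (hbound _ _ _ hω).le
  · filter_upwards [ae_restrict_mem measurableSet_Ioi] with ω hω u _
    have hne : ((ω / σ : ℝ) : ℂ) * Complex.I ≠ 0 :=
      mul_ne_zero (Complex.ofReal_ne_zero.2 (div_pos hω hσ).ne') Complex.I_ne_zero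
    have h1 : HasDerivAt (fun u : ℝ => Complex.I * ((ω * (u / σ) : ℝ) : ℂ))
        ((ω / σ : ℝ) * Complex.I) u := by
      convert! (((hasDerivAt_id u).div_const σ).const_mul ω).ofReal_comp.const_mul Complex.I
        using 1
      push_cast
      ring
    convert! (h1.cexp.const_mul ((Real.exp (-ω ^ 2 / 2) : ℝ) : ℂ)).mul_const
      (((ω / σ : ℝ) * Complex.I) ^ (ν - 1 : ℂ)) using 1
    rw [mul_assoc (_ : ℂ), mul_assoc (_ : ℂ), mul_assoc (_ : ℂ), Complex.cpow_sub _ _ hne,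
      Complex.cpow_one, mul_div_cancel₀ _ hne]

/-- The `ν`-th Riemann–Liouville fractional derivative of `f₀` based at `-∞`
(for `ν ∈ (0,1)`: the derivative of the fractional integral of order `1 - ν`)
has the one-sided Fourier representation
`√(2/π) ∫_0^∞ e^{-ω²/2} (ω/σ)^ν e^{i(ωt/σ + νπ/2)} dω`. -/
theorem fracDeriv_f0 (ν σ : ℝ) (hν0 : 0 < ν) (hν1 : ν < 1) (hσ : 0 < σ) (t : ℝ) :
    HasDerivAt
      (fun u : ℝ => ((1 / Real.Gamma (1 - ν) : ℝ) : ℂ) *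
        ∫ s in Set.Iio u, (((u - s) ^ (-ν) : ℝ) : ℂ) * f0 σ s)
      (((Real.sqrt (2 / Real.pi) : ℝ) : ℂ) *
        ∫ ω in Set.Ioi (0:ℝ),
          ((Real.exp (-ω ^ 2 / 2) * (ω / σ) ^ ν : ℝ) : ℂ) *
            Complex.exp (Complex.I * (ω * t / σ + ν * Real.pi / 2))) t := by
  have hΓ : ((1 / Real.Gamma (1 - ν) : ℝ) : ℂ) * (Real.Gamma (1 - ν) : ℂ) = 1 := by
    rw [← Complex.ofReal_mul, one_div_mul_cancel (Real.Gamma_pos_of_pos (by linarith)).ne',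
      Complex.ofReal_one]
  convert! (hasDerivAt_integral_exp_mul_cexp_mul_cpow hν0 hσ t).const_mul
    ((√(2 / π) : ℝ) : ℂ) using 1
  · ext u
    have h : ∫ r in Ioi (0 : ℝ), ((r ^ (-ν) : ℝ) : ℂ) * f0 σ (u - r) =
        (√(2 / π) : ℝ) * ∫ r in Ioi (0 : ℝ), ((r ^ (-ν) : ℝ) : ℂ) *
          halfGaussianFourier ((u - r) / σ) := by
      rw [← integral_const_mul]
      congr 1 with r
      rw [f0_eq hσ]
      ring
    rw [setIntegral_Iio_eq_setIntegral_Ioi_sub]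
    simp only [sub_sub_cancel]
    rw [h, integral_rpow_mul_halfGaussianFourier hν0 hν1 hσ,
      mul_left_comm, ← mul_assoc (_ : ℂ) (Real.Gamma (1 - ν) : ℂ), hΓ, one_mul]
  · congr 1
    refine setIntegral_congr_fun measurableSet_Ioi fun ω hω => ?_
    rw [ofReal_mul_I_cpow (div_pos hω hσ), mul_add Complex.I, Complex.exp_add,
      Complex.ofReal_mul (Real.exp _)]
    have : (ω * t / σ : ℂ) = (ω * (t / σ) : ℝ) := by
      push_cast
      ring
    rw [this]
    ring
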